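/- Let G be the finite Eulerian graph with vertices {e₀, f₀, e₁, f₁, e₂, f₂, e₃, f₃} and edges {e₀,f₀} and, for i ∈ {1,2,3}, {e₀,e_i}, {e_i,f_i}, {f_i,f₀}, and let p ∈ (0,1), q = p/(1−p). Then: (a) μ_{p,G}-almost surely, for each i ∈ {1,2,3} the three edges {e₀,e_i}, {e_i,f_i}, {f_i,f₀} are either all open or all closed (so their common state is X_i), and X₀ ≡ X₁ + X₂ + X₃ (mod 2); (b) for every ε = (ε₁,ε₂,ε₃) ∈ {0,1}³, μ_{p,G}(X₁ = ε₁, X₂ = ε₂, X₃ = ε₃) = q^{N(ε)}/Z(q), where N(ε) = 3(ε₁+ε₂+ε₃) + 1_{{ε₁+ε₂+ε₃ odd}} and Z(q) = 1 + 3q⁴ + 3q⁶ + q¹⁰. -/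

import Mathlib

open scoped BigOperators

noncomputable section

/-- The 8 vertices of the graph `G`: `0 = e₀`, `1 = f₀`, and for `i ∈ {1,2,3}`,
`2i = e_i` and `2i+1 = f_i`. -/
abbrev GVert : Type := Fin 8

/-- The 10 edges of the Eulerian graph `G`: the edge `{e₀,f₀}` and, for each
`i ∈ {1,2,3}`, the three edges `{e₀,e_i}`, `{e_i,f_i}`, `{f_i,f₀}`. -/
def gEdges : Fin 10 → GVert × GVert :=
  ![(0, 1), (0, 2), (2, 3), (3, 1), (0, 4), (4, 5), (5, 1), (0, 6), (6, 7), (7, 1)]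

/-- An edge configuration on `G`. -/
abbrev GConfig : Type := Fin 10 → Bool

/-- The degree of the vertex `v` in the subgraph of open edges of `ω`. -/
def gDeg (ω : GConfig) (v : GVert) : ℕ :=
  (Finset.univ.filter
    (fun i : Fin 10 => ((gEdges i).1 = v ∨ (gEdges i).2 = v) ∧ ω i = true)).card

/-- The subgraph of open edges of `ω` is even (Eulerian). -/
def gEven (ω : GConfig) : Prop := ∀ v : GVert, Even (gDeg ω v)

open Classical in
/-- The Bernoulli(`p`) weight of `ω`, restricted to even configurations. -/
def gWeight (p : ℝ) (ω : GConfig) : ℝ :=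
  (∏ i : Fin 10, if ω i then p else 1 - p) * (if gEven ω then 1 else 0)

open Classical in
/-- The probability of `A` under Eulerian percolation `μ_{p,G}` on `G`: Bernoulli(`p`)
bond percolation conditioned on the subgraph of open edges being even. -/
def gProb (p : ℝ) (A : Set GConfig) : ℝ :=
  (∑ ω : GConfig, if ω ∈ A then gWeight p ω else 0) / (∑ ω : GConfig, gWeight p ω)

/-- The expectation of `F` under Eulerian percolation `μ_{p,G}` on `G`. -/
def gExp (p : ℝ) (F : GConfig → ℝ) : ℝ :=
  (∑ ω : GConfig, F ω * gWeight p ω) / (∑ ω : GConfig, gWeight p ω)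


/-- `X_i` is the indicator that the edge `{e_i, f_i}` is open: edge `0` for `i = 0`,
edge `2` for `i = 1`, edge `5` for `i = 2`, edge `8` for `i = 3`. -/
def gC1 : Set GConfig := {ω | ω 0 = true ∧ ω 2 = true}

def gC2 : Set GConfig := {ω | ω 0 = true ∧ ω 5 = true}

def Zq (q : ℝ) : ℝ := 1 + 3 * q ^ 4 + 3 * q ^ 6 + q ^ 10

/-- The even configuration on `G` determined by `t ∈ {0,1}³`: the three edges on the `i`-th path
from `e₀` to `f₀` have state `tᵢ`, and `{e₀,f₀}` has state `t₁ + t₂ + t₃ (mod 2)`. -/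
def armConfig (t : Bool × Bool × Bool) : GConfig :=
  ![t.1 ^^ (t.2.1 ^^ t.2.2), t.1, t.1, t.1, t.2.1, t.2.1, t.2.1, t.2.2, t.2.2, t.2.2]

lemma armConfig_injective : Function.Injective armConfig := by
  rintro ⟨a, b, c⟩ ⟨a', b', c'⟩ h
  exact Prod.ext (congrFun h 2) (Prod.ext (congrFun h 5) (congrFun h 8))

lemma gEven_iff_exists_armConfig (ω : GConfig) : gEven ω ↔ ∃ t, armConfig t = ω := by
  constructor
  · intro h
    refine ⟨(ω 2, ω 5, ω 8), ?_⟩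
    have two : ∀ a b : Bool, Even ((if a = true then 1 else 0) + if b = true then 1 else 0) ↔
        a = b := by decide
    have four : ∀ a b c d : Bool, Even ((if a = true then 1 else 0) + ((if b = true then 1 else 0) +
        ((if c = true then 1 else 0) + if d = true then 1 else 0))) ↔ a = (b ^^ (c ^^ d)) := by
      decide
    simp only [gEven, gDeg, Finset.card_filter] at h
    simp [Fin.forall_fin_succ, Fin.sum_univ_succ, gEdges, -Finset.sum_boole,
      two, four] at h
    funext i
    fin_cases i <;> simp [armConfig, h]
  · rintro ⟨t, rfl⟩
    revert t
    unfold gEven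
    decide

lemma sum_mul_gWeight (p : ℝ) (F : GConfig → ℝ) :
    ∑ ω, F ω * gWeight p ω =
      ∑ t, F (armConfig t) * ∏ i, if armConfig t i then p else 1 - p := by
  symm
  refine Finset.sum_of_injOn armConfig armConfig_injective.injOn (by simp) ?_ ?_
  · intro ω _ hω
    have h : ¬ gEven ω := by
      rw [gEven_iff_exists_armConfig]
      simpa using hω
    simp [gWeight, h]
  · intro t _
    have h : gEven (armConfig t) := (gEven_iff_exists_armConfig _).2 ⟨t, rfl⟩
    simp [gWeight, h]

open Classical in
lemma gProb_eq_sum_armConfig (p : ℝ) (A : Set GConfig) :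
    gProb p A =
      (∑ t, (if armConfig t ∈ A then 1 else 0) * ∏ i, if armConfig t i then p else 1 - p) /
        ∑ t, ∏ i, if armConfig t i then p else 1 - p := by
  have h := sum_mul_gWeight p (fun _ => 1)
  simp only [one_mul] at h
  rw [gProb, h, ← sum_mul_gWeight p (fun ω => if ω ∈ A then 1 else 0)]
  simp only [ite_mul, one_mul, zero_mul]

lemma sum_prod_armConfig (p : ℝ) (hp : p ≠ 1) :
    (∑ t, ∏ i, if armConfig t i then p else 1 - p) = (1 - p) ^ 10 * Zq (p / (1 - p)) := by
  have h : 1 - p ≠ 0 := sub_ne_zero.2 hp.symm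
  simp [Fintype.sum_prod_type, Fin.prod_univ_succ, armConfig, Zq]
  field_simp
  ring

/-- (a) `μ_{p,G}`-almost surely, for each `i ∈ {1,2,3}` the three edges `{e₀,e_i}`,
`{e_i,f_i}`, `{f_i,f₀}` are all open or all closed, and `X₀ ≡ X₁ + X₂ + X₃ (mod 2)`;
(b) the law of `(X₁,X₂,X₃)` is given by `q^{N(ε)}/Z(q)`, where
`N(ε) = 3(ε₁+ε₂+ε₃) + 1_{ε₁+ε₂+ε₃ odd}` and `Z(q) = 1 + 3q⁴ + 3q⁶ + q¹⁰`. -/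
theorem gEulerian_structure (p : ℝ) (hp0 : 0 < p) (hp1 : p < 1)
    (q : ℝ) (hq : q = p / (1 - p)) :
    gProb p {ω : GConfig |
        (ω 1 = ω 2 ∧ ω 2 = ω 3) ∧ (ω 4 = ω 5 ∧ ω 5 = ω 6) ∧ (ω 7 = ω 8 ∧ ω 8 = ω 9) ∧
        (if ω 0 then 1 else 0) % 2 =
          ((if ω 2 then 1 else 0) + (if ω 5 then 1 else 0) + (if ω 8 then 1 else 0)) % 2}
      = 1 ∧
    ∀ ε₁ ε₂ ε₃ : Bool,
      gProb p {ω : GConfig | ω 2 = ε₁ ∧ ω 5 = ε₂ ∧ ω 8 = ε₃} =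
        q ^ (3 * ((if ε₁ then 1 else 0) + (if ε₂ then 1 else 0) + (if ε₃ then 1 else 0))
            + ((if ε₁ then 1 else 0) + (if ε₂ then 1 else 0) + (if ε₃ then 1 else 0)) % 2)
          / Zq q := by
  classical
  have h1 : 1 - p ≠ 0 := by linarith
  have hq0 : 0 < q := hq ▸ div_pos hp0 (by linarith)
  have hZ : Zq q ≠ 0 := by unfold Zq; positivity
  have hsum := sum_prod_armConfig p hp1.ne
  rw [← hq] at hsum
  have hpq : p = q * (1 - p) := by rw [hq, div_mul_cancel₀ _ h1]
  constructor
  · rw [gProb_eq_sum_armConfig, hsum, div_eq_one_iff_eq (by positivity), ← hsum]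
    refine Finset.sum_congr rfl fun t _ => ?_
    rw [if_pos, one_mul]
    revert t
    simp only [Set.mem_ofPred_eq]
    decide
  · intro ε₁ ε₂ ε₃
    rw [gProb_eq_sum_armConfig, hsum, Finset.sum_eq_single (ε₁, ε₂, ε₃)]
    · rw [if_pos (by simp [armConfig]), one_mul, div_eq_div_iff (by positivity) hZ,
        ← mul_assoc]
      congr 1
      generalize 1 - p = r at *
      subst hpq
      cases ε₁ <;> cases ε₂ <;> cases ε₃ <;>
        simp [Fin.prod_univ_succ, armConfig] <;> ring
    · rintro ⟨a, b, c⟩ _ hne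
      rw [if_neg, zero_mul]
      rintro ⟨ha, hb, hc⟩
      exact hne (Prod.ext ha (Prod.ext hb hc))
    · simp

end
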